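/- Let G be a discrete torsionfree subgroup of Isom(E^{1,2}) and let Ω be a regular domain with g(Ω) = Ω for all g ∈ G. Then every parabolic element φ ∈ G satisfies ⟨τ_φ, u⟩ = 0 for every vector u with φ_L(u) = u; equivalently, every parabolic element of G has a fixed point in ℝ³. -/

import Mathlib

noncomputable section

/-- Points/vectors of Minkowski space `E^{1,2}`. -/
abbrev V3 : Type := Fin 3 → ℝ

/-- The Minkowski bilinear form `⟨·,·⟩` of signature `(1,2)`. -/
def mb (v w : V3) : ℝ := -(v 0 * w 0) + v 1 * w 1 + v 2 * w 2

/-- The Minkowski quadratic form. -/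
def mq (v : V3) : ℝ := mb v v

def futureTimelike (v : V3) : Prop := mq v < 0 ∧ 0 < v 0
def futureLightlike (v : V3) : Prop := mq v = 0 ∧ 0 < v 0
def futureCausal (v : V3) : Prop := mq v ≤ 0 ∧ 0 < v 0

/-- `SO₀(1,2)`: linear maps preserving the form, of determinant one,
preserving the future causal cone. -/
def SO12 : Set (Matrix (Fin 3) (Fin 3) ℝ) :=
  {A | (∀ v w, mb (A.mulVec v) (A.mulVec w) = mb v w) ∧ A.det = 1 ∧
       ∀ v, futureCausal v → futureCausal (A.mulVec v)}

/-- A parabolic element of `SO₀(1,2)`. -/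
def IsParabolic (A : Matrix (Fin 3) (Fin 3) ℝ) : Prop := A ≠ 1 ∧ (A - 1) ^ 3 = 0

/-- An (affine) isometry of `E^{1,2}` given by its linear part and translation part. -/
abbrev IsomE : Type := Matrix (Fin 3) (Fin 3) ℝ × V3

/-- The action of an isometry on `ℝ³`: `φ(x) = φ_L x + τ_φ`. -/
def isomApp (g : IsomE) (x : V3) : V3 := g.1.mulVec x + g.2

/-- Composition of isometries. -/
def isomMul (g h : IsomE) : IsomE := (g.1 * h.1, g.1.mulVec h.2 + g.2)

/-- Iterated composition. -/
def isomPow (g : IsomE) : ℕ → IsomE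
  | 0 => (1, 0)
  | n + 1 => isomMul g (isomPow g n)

/-- `G` is a subgroup of `Isom(E^{1,2})`. -/
def IsIsomSubgroup (G : Set IsomE) : Prop :=
  (∀ g ∈ G, g.1 ∈ SO12) ∧ ((1 : Matrix (Fin 3) (Fin 3) ℝ), (0 : V3)) ∈ G ∧
  (∀ g ∈ G, ∀ h ∈ G, isomMul g h ∈ G) ∧
  (∀ g ∈ G, ∃ h ∈ G, isomMul g h = (1, 0) ∧ isomMul h g = (1, 0))

/-- `G` is torsionfree: its only element of finite order is the identity. -/
def IsomTorsionfree (G : Set IsomE) : Prop :=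
  ∀ g ∈ G, ∀ n : ℕ, 0 < n → isomPow g n = (1, 0) → g = (1, 0)

/-- The chronological future of the lightlike plane `{x | ⟨x,u⟩ = c}`. -/
def futurePlane (u : V3) (c : ℝ) : Set V3 := {x | mb x u < c}

/-- A regular domain: a nonempty intersection of futures of lightlike planes. -/
def IsRegularDomain (Ω : Set V3) : Prop :=
  Ω.Nonempty ∧ ∃ Λ : Set (V3 × ℝ), Λ.Nonempty ∧ (∀ p ∈ Λ, futureLightlike p.1) ∧
    Ω = ⋂ p ∈ Λ, futurePlane p.1 p.2

/-- The lightlike line `a + ℝ u`. -/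
def linePts (a u : V3) : Set V3 := {x | ∃ s : ℝ, x = a + s • u}

/-- Fixed-point set of an isometry. -/
def FixSet (g : IsomE) : Set V3 := {x | isomApp g x = x}


theorem mb_comm (v w : V3) : mb v w = mb w v := by
  unfold mb; ring

theorem mb_add_left (v v' w : V3) : mb (v + v') w = mb v w + mb v' w := by
  simp only [mb, Pi.add_apply]; ring

theorem mb_smul_left (a : ℝ) (v w : V3) : mb (a • v) w = a * mb v w := by
  simp only [mb, Pi.smul_apply, smul_eq_mul]; ring

theorem mb_add_right (v w w' : V3) : mb v (w + w') = mb v w + mb v w' := by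
  simp only [mb, Pi.add_apply]; ring

theorem mb_smul_right (a : ℝ) (v w : V3) : mb v (a • w) = a * mb v w := by
  simp only [mb, Pi.smul_apply, smul_eq_mul]; ring

theorem mb_zero_right (v : V3) : mb v 0 = 0 := by
  simp [mb]

/-- The Minkowski form is nondegenerate. -/
theorem eq_zero_of_forall_mb_eq_zero {u : V3} (h : ∀ v, mb v u = 0) : u = 0 := by
  have h0 := h ![1, 0, 0]
  have h1 := h ![0, 1, 0]
  have h2 := h ![0, 0, 1]
  simp [mb] at h0 h1 h2
  ext i
  fin_cases i <;> simp [h0, h1, h2]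

/-- An isotropic vector with vanishing time coordinate is zero. -/
theorem eq_zero_of_isotropic {r : V3} (hr : mb r r = 0) (h0 : r 0 = 0) : r = 0 := by
  simp only [mb, h0] at hr
  have h1 : r 1 = 0 := by nlinarith [sq_nonneg (r 1), sq_nonneg (r 2)]
  have h2 : r 2 = 0 := by nlinarith [sq_nonneg (r 1), sq_nonneg (r 2)]
  ext i
  fin_cases i <;> simp [h0, h1, h2]

/-- Orthogonal isotropic vectors are parallel. -/
theorem exists_eq_smul_of_isotropic {p q : V3} (hp : mb p p = 0) (hq : mb q q = 0)
    (hpq : mb p q = 0) (hp0 : p ≠ 0) : ∃ k : ℝ, q = k • p := by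
  have h0 : p 0 ≠ 0 := fun h => hp0 (eq_zero_of_isotropic hp h)
  refine ⟨q 0 / p 0, ?_⟩
  have hr : q + (-(q 0 / p 0)) • p = 0 := by
    apply eq_zero_of_isotropic
    · simp only [mb_add_left, mb_add_right, mb_smul_left, mb_smul_right, mb_comm q p, hp, hq, hpq]
      ring
    · simp only [Pi.add_apply, Pi.smul_apply, smul_eq_mul]
      field_simp
      ring
  rwa [neg_smul, ← sub_eq_add_neg, sub_eq_zero] at hr

/-- If `v ↦ v + f v` preserves the form and `f ^ 2 = 0`, then `f = 0`. -/
theorem eq_zero_of_sq_eq_zero {f : V3 →ₗ[ℝ] V3}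
    (hiso : ∀ v w, mb (f v) w + mb v (f w) + mb (f v) (f w) = 0)
    (hsq : ∀ v, f (f v) = 0) (w : V3) : f w = 0 := by
  by_contra hw
  have him : ∀ v w, mb (f v) (f w) = 0 := fun v w => by
    simpa [hsq, mb_zero_right] using hiso v (f w)
  have hww : mb (f w) w = 0 := by
    have h := hiso w w
    rw [him, mb_comm w] at h
    linarith
  refine hw (eq_zero_of_forall_mb_eq_zero fun v => ?_)
  obtain ⟨k, hk⟩ := exists_eq_smul_of_isotropic (him w w) (him v v) (him w v) hw
  have h := hiso v w
  rw [him, hk, mb_smul_left, hww] at h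
  linarith

/-- If `f` is nilpotent of maximal order on `ℝ³`, then `ker (f ^ 2) ⊆ range f`. -/
theorem exists_eq_of_sq_eq_zero {f : V3 →ₗ[ℝ] V3} (hnil : ∀ v, f (f (f v)) = 0)
    {w : V3} (hw : f (f w) ≠ 0) {t : V3} (ht : f (f t) = 0) : ∃ x, f x = t := by
  have hli : LinearIndependent ℝ ![w, f w, f (f w)] := by
    rw [Fintype.linearIndependent_iff]
    intro g hg
    simp only [Fin.sum_univ_three, Matrix.cons_val] at hg
    have h0 : g 0 = 0 := by
      have h := congrArg (fun z => f (f z)) hg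
      simpa [hnil, hw] using h
    have h1 : g 1 = 0 := by
      have h := congrArg f hg
      simpa [hnil, hw, h0] using h
    have h2 : g 2 = 0 := by simpa [hw, h0, h1] using hg
    intro i
    fin_cases i <;> assumption
  have hmem : t ∈ Submodule.span ℝ (Set.range ![w, f w, f (f w)]) := by
    rw [hli.span_eq_top_of_card_eq_finrank (by simp)]
    trivial
  obtain ⟨g, rfl⟩ := (Submodule.mem_span_range_iff_exists_fun ℝ).1 hmem
  simp only [Fin.sum_univ_three, Matrix.cons_val] at ht ⊢
  have h0 : g 0 = 0 := by simpa [hnil, hw] using ht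
  exact ⟨g 1 • w + g 2 • f w, by simp [h0]⟩

/-- A real cubic bounded above on `ℕ` has nonpositive leading coefficient. -/
theorem leadingCoeff_nonpos_of_bounded {a b c d C : ℝ}
    (h : ∀ n : ℕ, a + b * n + c * n ^ 2 + d * n ^ 3 < C) : d ≤ 0 := by
  by_contra! hd
  obtain ⟨m, hm⟩ := exists_nat_gt ((|C| + |a| + |b| + |c|) / d)
  rw [div_lt_iff₀ hd] at hm
  have hn := h (m + 1)
  push_cast at hn
  set n : ℝ := (m : ℝ) + 1 with hndef
  have hn1 : 1 ≤ n := by simp [hndef]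
  have hn2 : n ≤ n ^ 2 := by nlinarith
  have ha : -(|a| * n ^ 2) ≤ a := by nlinarith [neg_abs_le a, abs_nonneg a]
  have hb : -(|b| * n ^ 2) ≤ b * n := by nlinarith [neg_abs_le b, abs_nonneg b]
  have hc : -(|c| * n ^ 2) ≤ c * n ^ 2 := by nlinarith [neg_abs_le c, abs_nonneg c]
  have hC : C ≤ |C| * n ^ 2 := by nlinarith [le_abs_self C, abs_nonneg C]
  have hdn : |C| + |a| + |b| + |c| < n * d := by nlinarith
  nlinarith [mul_lt_mul_of_pos_right hdn (by positivity : 0 < n ^ 2)]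

/-- A real cubic bounded above on `ℤ` has vanishing leading coefficient. -/
theorem leadingCoeff_eq_zero_of_bounded {a b c d C : ℝ}
    (h : ∀ n : ℤ, a + b * n + c * n ^ 2 + d * n ^ 3 < C) : d = 0 := by
  apply le_antisymm
  · exact leadingCoeff_nonpos_of_bounded fun n => by simpa using h n
  · have := leadingCoeff_nonpos_of_bounded (a := a) (b := -b) (c := c) (d := -d) (C := C)
      fun n => by
        have := h (-n)
        push_cast at this
        linarith
    linarith

/-- A real affine function bounded above on `ℤ` is constant. -/
theorem slope_eq_zero_of_bounded {a b C : ℝ} (h : ∀ n : ℤ, a + b * n < C) : b = 0 := by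
  by_contra hb
  obtain ⟨n, hn⟩ : ∃ n : ℤ, C - a < b * n := by
    rcases lt_or_gt_of_ne hb with hb | hb
    · obtain ⟨n, hn⟩ := exists_int_lt ((C - a) / b)
      exact ⟨n, by rwa [lt_div_iff_of_neg' hb] at hn⟩
    · obtain ⟨n, hn⟩ := exists_int_gt ((C - a) / b)
      exact ⟨n, by rwa [div_lt_iff₀' hb] at hn⟩
  linarith [h n]

/-- The orbit of `x` under `z ↦ z + f z + t`, for `f ^ 3 = 0`, where `d = f x + t`. -/
def orbitPt (f : V3 →ₗ[ℝ] V3) (x d : V3) (n : ℤ) : V3 :=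
  x + (n : ℝ) • d + ((n : ℝ) * (n - 1) / 2) • f d
    + ((n : ℝ) * (n - 1) * (n - 2) / 6) • f (f d)

theorem orbitPt_succ {f : V3 →ₗ[ℝ] V3} (hnil : ∀ v, f (f (f v)) = 0) (x t : V3) (n : ℤ) :
    orbitPt f x (f x + t) n + f (orbitPt f x (f x + t) n) + t
      = orbitPt f x (f x + t) (n + 1) := by
  simp only [orbitPt, map_add, map_smul, hnil, map_zero]
  push_cast
  module

theorem orbitPt_mem {f : V3 →ₗ[ℝ] V3} (hnil : ∀ v, f (f (f v)) = 0) {x t : V3} {Ω : Set V3}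
    (hinj : Function.Injective fun z => z + f z + t)
    (hinv : (fun z => z + f z + t) '' Ω = Ω) (hx : x ∈ Ω) (n : ℤ) :
    orbitPt f x (f x + t) n ∈ Ω := by
  have hiff : ∀ m, orbitPt f x (f x + t) (m + 1) ∈ Ω ↔ orbitPt f x (f x + t) m ∈ Ω := by
    intro m
    rw [← orbitPt_succ hnil]
    conv_lhs => rw [← hinv]
    exact hinj.mem_set_image (a := orbitPt f x (f x + t) m)
  induction n using Int.induction_on with
  | zero => simpa [orbitPt] using hx
  | succ i ih => exact (hiff _).2 ih
  | pred i ih => exact (hiff _).1 (by simpa using ih)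

/-- A lightlike half-space containing a full orbit of `z ↦ z + f z + t` forces `f (f t) = 0`. -/
theorem sq_translation_eq_zero {f : V3 →ₗ[ℝ] V3} (hnil : ∀ v, f (f (f v)) = 0)
    (hiso : ∀ v w, mb (f v) w + mb v (f w) + mb (f v) (f w) = 0) {x t v : V3} {c : ℝ}
    (hv : mb v v = 0) (hv0 : v ≠ 0)
    (hbd : ∀ n, mb (orbitPt f x (f x + t) n) v < c) : f (f t) = 0 := by
  by_contra hne
  have horth : ∀ y, mb (f y) (f (f t)) = 0 := fun y => by
    simpa [hnil, mb_zero_right] using hiso y (f (f t))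
  have hcub : mb (f (f t)) v / 6 = 0 := by
    apply leadingCoeff_eq_zero_of_bounded (a := mb x v)
      (b := mb (f x + t) v - mb (f (f x + t)) v / 2 + mb (f (f t)) v / 3)
      (c := mb (f (f x + t)) v / 2 - mb (f (f t)) v / 2) (C := c)
    intro n
    have h := hbd n
    have hd : f (f (f x + t)) = f (f t) := by simp [hnil]
    simp only [orbitPt, mb_add_left _ _ v, mb_smul_left, hd] at h
    rw [mb_add_left (f x) t v]
    linarith
  obtain ⟨k, rfl⟩ := exists_eq_smul_of_isotropic (horth (f t)) hv (by linarith) hne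
  have hlin : mb t (k • f (f t)) = 0 := by
    apply slope_eq_zero_of_bounded (a := mb x (k • f (f t))) (C := c)
    intro n
    have h := hbd n
    simp only [orbitPt, mb_add_left, mb_smul_left, mb_smul_right, horth] at h ⊢
    linarith
  have hk : k ≠ 0 := by
    rintro rfl
    simp at hv0
  have htt : mb t (f (f t)) = 0 := by
    rw [mb_smul_right] at hlin
    exact (mul_eq_zero.1 hlin).resolve_left hk
  have hft : mb (f t) (f t) = 0 := by
    have h := hiso t (f t)
    rw [horth, htt] at h
    linarith
  obtain ⟨l, hl⟩ := exists_eq_smul_of_isotropic (horth (f t)) hft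
    (by rw [mb_comm]; exact horth t) hne
  apply hne
  rw [hl, map_smul, hnil, smul_zero]

/-- Every parabolic element of a discrete torsionfree subgroup of
`Isom(E^{1,2})` preserving a regular domain has a tangent translation part;
equivalently it has a fixed point. -/
theorem stmt11 (G : Set IsomE) (hG : IsIsomSubgroup G)
    (hdisc : DiscreteTopology ↥G) (htf : IsomTorsionfree G)
    (Ω : Set V3) (hΩ : IsRegularDomain Ω)
    (hinv : ∀ g ∈ G, isomApp g '' Ω = Ω)
    (φ : IsomE) (hφ : φ ∈ G) (hpar : IsParabolic φ.1) :
    (∀ u : V3, φ.1.mulVec u = u → mb φ.2 u = 0) ∧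
    (∃ x : V3, isomApp φ x = x) := by
  obtain ⟨A, t⟩ := φ
  obtain ⟨hA1, hA3⟩ := hpar
  obtain ⟨hA, hdet, -⟩ := hG.1 _ hφ
  have hφinv := hinv _ hφ
  dsimp only at *
  set f : V3 →ₗ[ℝ] V3 := (A - 1).mulVecLin with hf
  have hAf : ∀ v, A.mulVec v = v + f v := fun v => by
    simp [hf]
  have hnil : ∀ v, f (f (f v)) = 0 := fun v => by
    simp only [hf, Matrix.mulVecLin_apply, Matrix.mulVec_mulVec]
    rw [← pow_two, ← pow_succ', hA3, Matrix.zero_mulVec]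
  have hiso : ∀ v w, mb (f v) w + mb v (f w) + mb (f v) (f w) = 0 := fun v w => by
    have h := hA v w
    simp only [hAf, mb_add_left, mb_add_right] at h
    linarith
  have happ : isomApp (A, t) = fun z => z + f z + t := funext fun z => by
    simp [isomApp, hAf]
  have hinj : Function.Injective fun z => z + f z + t := by
    intro y z hyz
    simp only [add_left_inj, ← hAf] at hyz
    exact Matrix.mulVec_injective_of_isUnit ((Matrix.isUnit_iff_isUnit_det A).2 (by simp [hdet])) hyz
  rw [happ] at hφinv
  obtain ⟨⟨x, hx⟩, Λ, ⟨p, hp⟩, hlight, hΩeq⟩ := hΩ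
  have hsq : f (f t) = 0 := by
    refine sq_translation_eq_zero (x := x) (v := p.1) (c := p.2) hnil hiso (hlight p hp).1 ?_ ?_
    · intro h0
      have := (hlight p hp).2
      simp [h0] at this
    · intro n
      have h := orbitPt_mem hnil hinj hφinv hx n
      rw [hΩeq] at h
      exact Set.mem_iInter₂.1 h p hp
  obtain ⟨w, hw⟩ : ∃ w, f (f w) ≠ 0 := by
    by_contra! h
    have h0 := eq_zero_of_sq_eq_zero hiso h
    apply hA1
    apply Matrix.mulVec_injective
    funext v
    rw [hAf, h0, add_zero, Matrix.one_mulVec]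
  obtain ⟨y, rfl⟩ := exists_eq_of_sq_eq_zero hnil hw hsq
  refine ⟨fun u hu => ?_, -y, ?_⟩
  · have hfu : f u = 0 := by simpa [hAf] using hu
    simpa [hfu, mb_zero_right] using hiso y u
  · rw [happ]
    simp
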